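/- Let A₁₀ = ℚ[g₄,g₆,h₆,k₆]/(g₆² + 2h₆² + k₆², 4g₄³ + 27h₆² + k₆²) and let G be the group of ℚ-algebra automorphisms of A₁₀ generated by the two involutions σ₂ (g₄ ↦ g₄, g₆ ↦ g₆, h₆ ↦ −h₆, k₆ ↦ −k₆) and σ₅ (g₄ ↦ g₄, g₆ ↦ −g₆, h₆ ↦ h₆, k₆ ↦ −k₆). Then the ℚ-algebra homomorphism ℚ[x,y,z] → A₁₀ given by x ↦ g₄, y ↦ g₆², z ↦ g₆h₆k₆ sends 32x⁶y − 116x³y² + 27y³ + 625z² to 0 and induces a ℚ-algebra isomorphism ℚ[x,y,z]/(32x⁶y − 116x³y² + 27y³ + 625z²) ≅ A₁₀^G, where A₁₀^G is the subalgebra of elements of A₁₀ fixed by every element of G. -/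

import Mathlib

open MvPolynomial

/-- The canonical ring `A₁₀ = ℚ[g₄,g₆,h₆,k₆]/(g₆² + 2h₆² + k₆², 4g₄³ + 27h₆² + k₆²)` of
the Shimura curve of discriminant 10; the variables `X 0, X 1, X 2, X 3` play the roles
of `g₄, g₆, h₆, k₆`. -/
noncomputable abbrev A10 : Type :=
  MvPolynomial (Fin 4) ℚ ⧸
    Ideal.span {(X 1 : MvPolynomial (Fin 4) ℚ) ^ 2 + 2 * X 2 ^ 2 + X 3 ^ 2,
      4 * (X 0 : MvPolynomial (Fin 4) ℚ) ^ 3 + 27 * X 2 ^ 2 + X 3 ^ 2}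

/-- The class of `g₄` in `A₁₀`. -/
noncomputable def g4 : A10 := Ideal.Quotient.mk _ (X 0)

/-- The class of `g₆` in `A₁₀`. -/
noncomputable def g6 : A10 := Ideal.Quotient.mk _ (X 1)

/-- The class of `h₆` in `A₁₀`. -/
noncomputable def h6 : A10 := Ideal.Quotient.mk _ (X 2)

/-- The class of `k₆` in `A₁₀`. -/
noncomputable def k6 : A10 := Ideal.Quotient.mk _ (X 3)

/-- The subalgebra of elements of an `R`-algebra `A` fixed by every element of a group `G`
of `R`-algebra automorphisms of `A`. -/
def fixedSubalgebra (R A : Type*) [CommSemiring R] [Semiring A] [Algebra R A]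
    (G : Subgroup (A ≃ₐ[R] A)) : Subalgebra R A where
  carrier := {a : A | ∀ g ∈ G, g a = a}
  mul_mem' := fun ha hb g hg => by
    rw [map_mul, ha g hg, hb g hg]
  one_mem' := fun g _ => map_one g
  add_mem' := fun ha hb g hg => by
    rw [map_add, ha g hg, hb g hg]
  zero_mem' := fun g _ => map_zero g
  algebraMap_mem' := fun r g _ => g.commutes r

/-- The relation `g₆² + 2h₆² + k₆² = 0` in `A₁₀`. -/
theorem g6_sq_add_two_mul_h6_sq_add_k6_sq : g6 ^ 2 + 2 * h6 ^ 2 + k6 ^ 2 = 0 := by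
  have h := (Ideal.Quotient.eq_zero_iff_mem (I := Ideal.span
    {(X 1 : MvPolynomial (Fin 4) ℚ) ^ 2 + 2 * X 2 ^ 2 + X 3 ^ 2,
      4 * (X 0 : MvPolynomial (Fin 4) ℚ) ^ 3 + 27 * X 2 ^ 2 + X 3 ^ 2})).2
    (Ideal.subset_span (Set.mem_insert _ _))
  simp only [map_add, map_mul, map_pow, map_ofNat] at h
  exact h

/-- The relation `4g₄³ + 27h₆² + k₆² = 0` in `A₁₀`. -/
theorem four_mul_g4_cube_add_h6_sq_add_k6_sq : 4 * g4 ^ 3 + 27 * h6 ^ 2 + k6 ^ 2 = 0 := by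
  have h := (Ideal.Quotient.eq_zero_iff_mem (I := Ideal.span
    {(X 1 : MvPolynomial (Fin 4) ℚ) ^ 2 + 2 * X 2 ^ 2 + X 3 ^ 2,
      4 * (X 0 : MvPolynomial (Fin 4) ℚ) ^ 3 + 27 * X 2 ^ 2 + X 3 ^ 2})).2
    (Ideal.subset_span (Set.mem_insert_of_mem _ rfl))
  simp only [map_add, map_mul, map_pow, map_ofNat] at h
  exact h

/-- `h₆²` as a polynomial in `g₄` and `g₆²`. -/
theorem h6_sq_eq : h6 ^ 2 = (1 / 25 : ℚ) • (g6 ^ 2 - 4 * g4 ^ 3) := by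
  have h : (25 : ℚ) • h6 ^ 2 = g6 ^ 2 - 4 * g4 ^ 3 := by
    rw [ofNat_smul_eq_nsmul, nsmul_eq_mul, Nat.cast_ofNat]
    linear_combination four_mul_g4_cube_add_h6_sq_add_k6_sq - g6_sq_add_two_mul_h6_sq_add_k6_sq
  rw [← h, smul_smul]
  norm_num

/-- `k₆²` as a polynomial in `g₄` and `g₆²`. -/
theorem k6_sq_eq : k6 ^ 2 = (1 / 25 : ℚ) • (8 * g4 ^ 3 - 27 * g6 ^ 2) := by
  have h : (25 : ℚ) • k6 ^ 2 = 8 * g4 ^ 3 - 27 * g6 ^ 2 := by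
    rw [ofNat_smul_eq_nsmul, nsmul_eq_mul, Nat.cast_ofNat]
    linear_combination 27 * g6_sq_add_two_mul_h6_sq_add_k6_sq -
      2 * four_mul_g4_cube_add_h6_sq_add_k6_sq
  rw [← h, smul_smul]
  norm_num

/-- Every element of `A₁₀` is a polynomial expression in `g₄, g₆, h₆, k₆`. -/
theorem A10_induction {p : A10 → Prop}
    (monomial : ∀ (r : ℚ) (a b c d : ℕ), p (r • (g4 ^ a * g6 ^ b * h6 ^ c * k6 ^ d)))
    (add : ∀ x y, p x → p y → p (x + y)) (x : A10) : p x := by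
  obtain ⟨q, rfl⟩ := Ideal.Quotient.mk_surjective x
  induction q using MvPolynomial.induction_on' with
  | monomial u r =>
    have := monomial r (u 0) (u 1) (u 2) (u 3)
    rw [MvPolynomial.monomial_eq, Finsupp.prod_fintype _ _ (by simp), Fin.prod_univ_four,
      ← MvPolynomial.smul_eq_C_mul]
    exact this
  | add q₁ q₂ h₁ h₂ => rw [map_add]; exact add _ _ h₁ h₂

/-- The weighted equation of the quotient curve. -/
noncomputable abbrev quotientRelation : MvPolynomial (Fin 3) ℚ :=
  32 * (X 0 : MvPolynomial (Fin 3) ℚ) ^ 6 * X 1 - 116 * X 0 ^ 3 * X 1 ^ 2 +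
    27 * X 1 ^ 3 + 625 * X 2 ^ 2

/-- The homomorphism `x ↦ g₄, y ↦ g₆², z ↦ g₆h₆k₆`. -/
noncomputable abbrev invariantHom : MvPolynomial (Fin 3) ℚ →ₐ[ℚ] A10 :=
  aeval (![g4, g6 ^ 2, g6 * h6 * k6] : Fin 3 → A10)

theorem invariantHom_quotientRelation : invariantHom quotientRelation = 0 := by
  simp only [map_add, map_sub, map_mul, map_pow, map_ofNat, aeval_X, Matrix.cons_val]
  have h₁ := g6_sq_add_two_mul_h6_sq_add_k6_sq
  have h₂ := four_mul_g4_cube_add_h6_sq_add_k6_sq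
  have hh : 25 * h6 ^ 2 = g6 ^ 2 - 4 * g4 ^ 3 := by linear_combination h₂ - h₁
  have hk : 25 * k6 ^ 2 = 8 * g4 ^ 3 - 27 * g6 ^ 2 := by linear_combination 27 * h₁ - 2 * h₂
  linear_combination g6 ^ 2 * (25 * k6 ^ 2) * hh + g6 ^ 2 * (g6 ^ 2 - 4 * g4 ^ 3) * hk

theorem g4_mem_range : g4 ∈ invariantHom.range := ⟨X 0, by simp⟩

theorem g6_sq_mem_range : g6 ^ 2 ∈ invariantHom.range := ⟨X 1, by simp⟩

theorem g6_mul_h6_mul_k6_mem_range : g6 * h6 * k6 ∈ invariantHom.range := ⟨X 2, by simp⟩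

theorem h6_sq_mem_range : h6 ^ 2 ∈ invariantHom.range := by
  rw [h6_sq_eq]
  exact Subalgebra.smul_mem _ (sub_mem g6_sq_mem_range
    (mul_mem (ofNat_mem _ 4) (pow_mem g4_mem_range 3))) _

theorem k6_sq_mem_range : k6 ^ 2 ∈ invariantHom.range := by
  rw [k6_sq_eq]
  exact Subalgebra.smul_mem _ (sub_mem (mul_mem (ofNat_mem _ 8) (pow_mem g4_mem_range 3))
    (mul_mem (ofNat_mem _ 27) g6_sq_mem_range)) _

/-- A monomial whose exponents of `g₆, h₆, k₆` have the same parity is in the image of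
`invariantHom`. -/
theorem monomial_mem_range {b c d : ℕ} (hbd : Even (b + d)) (hcd : Even (c + d)) (a : ℕ) :
    g4 ^ a * g6 ^ b * h6 ^ c * k6 ^ d ∈ invariantHom.range := by
  have key : ∀ i j l : ℕ, g4 ^ a * (g6 ^ 2) ^ i * (h6 ^ 2) ^ j * (k6 ^ 2) ^ l ∈
      invariantHom.range := fun i j l =>
    mul_mem (mul_mem (mul_mem (pow_mem g4_mem_range a) (pow_mem g6_sq_mem_range i))
      (pow_mem h6_sq_mem_range j)) (pow_mem k6_sq_mem_range l)
  rcases Nat.even_or_odd' d with ⟨l, rfl | rfl⟩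
  · obtain ⟨i, rfl⟩ : ∃ i, b = 2 * i := ⟨b / 2, by grind⟩
    obtain ⟨j, rfl⟩ : ∃ j, c = 2 * j := ⟨c / 2, by grind⟩
    simpa only [pow_mul] using key i j l
  · obtain ⟨i, rfl⟩ : ∃ i, b = 2 * i + 1 := ⟨b / 2, by grind⟩
    obtain ⟨j, rfl⟩ : ∃ j, c = 2 * j + 1 := ⟨c / 2, by grind⟩
    have := mul_mem (key i j l) g6_mul_h6_mul_k6_mem_range
    convert this using 1
    ring

/-- The sum of the conjugates of an element of `A₁₀` under the Klein four-group `{1, σ₂, σ₅, σ₂σ₅}` is in the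
image of `invariantHom`. -/
theorem sum_orbit_mem_range (σ₂ σ₅ : A10 ≃ₐ[ℚ] A10)
    (hσ₂g4 : σ₂ g4 = g4) (hσ₂g6 : σ₂ g6 = g6) (hσ₂h6 : σ₂ h6 = -h6) (hσ₂k6 : σ₂ k6 = -k6)
    (hσ₅g4 : σ₅ g4 = g4) (hσ₅g6 : σ₅ g6 = -g6) (hσ₅h6 : σ₅ h6 = h6)
    (hσ₅k6 : σ₅ k6 = -k6) (x : A10) :
    x + σ₂ x + σ₅ x + σ₂ (σ₅ x) ∈ invariantHom.range := by
  induction x using A10_induction with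
  | add x y hx hy =>
    simp only [map_add]
    convert add_mem hx hy using 1
    ring
  | monomial r a b c d =>
    simp only [map_smul, ← smul_add]
    refine Subalgebra.smul_mem _ ?_ r
    simp only [map_mul, map_pow, map_neg, hσ₂g4, hσ₂g6, hσ₂h6, hσ₂k6, hσ₅g4, hσ₅g6, hσ₅h6, hσ₅k6,
      neg_neg]
    rcases Nat.even_or_odd b with hb | hb <;> rcases Nat.even_or_odd c with hc | hc <;>
      rcases Nat.even_or_odd d with hd | hd <;>
      simp only [hb.neg_pow g6, hc.neg_pow h6, hd.neg_pow k6]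
    case inl.inl.inl | inr.inr.inr =>
      have h := monomial_mem_range (b := b) (c := c) (d := d) (by grind) (by grind) a
      convert add_mem (add_mem (add_mem h h) h) h using 1 <;> ring
    all_goals
      convert zero_mem invariantHom.range using 1
      ring

/-- An element fixed by `σ₂` and `σ₅` is in the image of `invariantHom`. -/
theorem mem_range_of_fixed (σ₂ σ₅ : A10 ≃ₐ[ℚ] A10)
    (hσ₂g4 : σ₂ g4 = g4) (hσ₂g6 : σ₂ g6 = g6) (hσ₂h6 : σ₂ h6 = -h6) (hσ₂k6 : σ₂ k6 = -k6)
    (hσ₅g4 : σ₅ g4 = g4) (hσ₅g6 : σ₅ g6 = -g6) (hσ₅h6 : σ₅ h6 = h6)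
    (hσ₅k6 : σ₅ k6 = -k6) {x : A10} (h₂ : σ₂ x = x) (h₅ : σ₅ x = x) :
    x ∈ invariantHom.range := by
  have h := sum_orbit_mem_range σ₂ σ₅ hσ₂g4 hσ₂g6 hσ₂h6 hσ₂k6 hσ₅g4 hσ₅g6 hσ₅h6 hσ₅k6 x
  rw [h₅, h₂] at h
  have hx : x = (1 / 4 : ℚ) • (x + x + x + x) := by
    rw [show x + x + x + x = (4 : ℚ) • x by rw [ofNat_smul_eq_nsmul, nsmul_eq_mul, Nat.cast_ofNat]; ring, smul_smul]
    norm_num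
  rw [hx]
  exact Subalgebra.smul_mem _ h _

/-- The image of `invariantHom` is fixed by the group generated by `σ₂` and `σ₅`. -/
theorem invariantHom_mem_fixedSubalgebra (σ₂ σ₅ : A10 ≃ₐ[ℚ] A10)
    (hσ₂g4 : σ₂ g4 = g4) (hσ₂g6 : σ₂ g6 = g6) (hσ₂h6 : σ₂ h6 = -h6) (hσ₂k6 : σ₂ k6 = -k6)
    (hσ₅g4 : σ₅ g4 = g4) (hσ₅g6 : σ₅ g6 = -g6) (hσ₅h6 : σ₅ h6 = h6)
    (hσ₅k6 : σ₅ k6 = -k6) (q : MvPolynomial (Fin 3) ℚ) :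
    invariantHom q ∈ fixedSubalgebra ℚ A10 (Subgroup.closure {σ₂, σ₅}) := by
  have hgen : ∀ σ ∈ ({σ₂, σ₅} : Set (A10 ≃ₐ[ℚ] A10)), σ (invariantHom q) = invariantHom q := by
    intro σ hσ
    suffices (σ : A10 →ₐ[ℚ] A10).comp invariantHom = invariantHom from
      DFunLike.congr_fun this q
    ext i
    rcases hσ with rfl | rfl <;> fin_cases i <;> simp [*] <;> ring
  intro σ hσ
  induction hσ using Subgroup.closure_induction with
  | mem σ hσ => exact hgen σ hσ
  | one => rfl
  | mul σ τ _ _ h₁ h₂ => rw [AlgEquiv.mul_apply, h₂, h₁]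
  | inv σ _ h => exact (AlgEquiv.symm_apply_eq σ).2 h.symm

/-- Bivariate polynomials, as polynomials in `X 0` and `X 1` among three variables. -/
noncomputable def bivariateHom : Polynomial (Polynomial ℚ) →+* MvPolynomial (Fin 3) ℚ :=
  Polynomial.eval₂RingHom
    (Polynomial.aeval (X 0 : MvPolynomial (Fin 3) ℚ) : Polynomial ℚ →ₐ[ℚ] _).toRingHom (X 1)

theorem bivariateHom_C_X : bivariateHom (Polynomial.C Polynomial.X) = X 0 := by
  simp [bivariateHom]

theorem bivariateHom_X : bivariateHom Polynomial.X = X 1 := by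
  simp [bivariateHom]

/-- The polynomial `32x⁶y − 116x³y² + 27y³`, in the variable `y` over `ℚ[x]`. -/
noncomputable def ramification : Polynomial (Polynomial ℚ) :=
  32 * Polynomial.C Polynomial.X ^ 6 * Polynomial.X -
    116 * Polynomial.C Polynomial.X ^ 3 * Polynomial.X ^ 2 + 27 * Polynomial.X ^ 3

theorem natDegree_ramification : ramification.natDegree = 3 := by
  have h : ramification = Polynomial.C 27 * Polynomial.X ^ 3 +
      Polynomial.C (-116 * Polynomial.X ^ 3) * Polynomial.X ^ 2 +
      Polynomial.C (32 * Polynomial.X ^ 6) * Polynomial.X + Polynomial.C 0 := by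
    simp only [ramification, map_mul, map_neg, map_pow, map_ofNat, map_zero]
    ring
  rw [h, Polynomial.natDegree_cubic (by norm_num)]

/-- Modulo the defining relation, every polynomial in `x, y, z` is linear in `z`. -/
theorem exists_sub_mem_span (q : MvPolynomial (Fin 3) ℚ) :
    ∃ u v : Polynomial (Polynomial ℚ),
      q - (bivariateHom u + bivariateHom v * X 2) ∈ Ideal.span {quotientRelation} := by
  induction q using MvPolynomial.induction_on with
  | C r =>
    refine ⟨Polynomial.C (Polynomial.C r), 0, ?_⟩
    simp [bivariateHom, MvPolynomial.algebraMap_eq]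
  | add p q hp hq =>
    obtain ⟨u, v, h⟩ := hp
    obtain ⟨u', v', h'⟩ := hq
    refine ⟨u + u', v + v', ?_⟩
    convert add_mem h h' using 1
    simp only [map_add]
    ring
  | mul_X p i hp =>
    obtain ⟨u, v, h⟩ := hp
    fin_cases i
    · refine ⟨u * Polynomial.C Polynomial.X, v * Polynomial.C Polynomial.X, ?_⟩
      convert Ideal.mul_mem_right (X 0) _ h using 1
      simp only [map_mul, bivariateHom_C_X, Fin.zero_eta]
      ring
    · refine ⟨u * Polynomial.X, v * Polynomial.X, ?_⟩
      convert Ideal.mul_mem_right (X 1) _ h using 1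
      simp only [map_mul, bivariateHom_X, Fin.mk_one]
      ring
    · refine ⟨Polynomial.C (Polynomial.C (-1 / 625)) * v * ramification, u, ?_⟩
      have hrel : bivariateHom v * C (1 / 625) * quotientRelation ∈
          Ideal.span {quotientRelation} :=
        Ideal.mul_mem_left _ _ (Ideal.mem_span_singleton_self _)
      convert add_mem (Ideal.mul_mem_right (X 2) _ h) hrel using 1
      have hC : bivariateHom (Polynomial.C (Polynomial.C (-1 / 625))) =
          -C (1 / 625 : ℚ) := by
        simp [bivariateHom, MvPolynomial.algebraMap_eq, neg_div]
      have hone : C (1 / 625 : ℚ) * 625 = (1 : MvPolynomial (Fin 3) ℚ) := by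
        rw [← map_ofNat (C : ℚ →+* MvPolynomial (Fin 3) ℚ) 625, ← map_mul]
        norm_num
      simp only [ramification, map_mul, map_add, map_sub, map_pow, map_ofNat, hC,
        bivariateHom_C_X, bivariateHom_X, Fin.reduceFinMk, quotientRelation]
      linear_combination (-bivariateHom v * X 2 ^ 2) * hone

/-- Since `ramification` has odd degree in `y`, `625u² + v² * ramification` has no nontrivial
zeros. -/
theorem eq_zero_of_sq_add_sq_mul_ramification {u v : Polynomial (Polynomial ℚ)}
    (h : 625 * u ^ 2 + v ^ 2 * ramification = 0) : u = 0 ∧ v = 0 := by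
  have hv : v = 0 := by
    by_contra hv
    have hr : ramification ≠ 0 := fun h0 => by
      simpa [h0] using natDegree_ramification
    have h625 : (625 : Polynomial (Polynomial ℚ)) = Polynomial.C 625 :=
      (map_ofNat Polynomial.C 625).symm
    have heq : (Polynomial.C 625 * u ^ 2).natDegree = (v ^ 2 * ramification).natDegree := by
      rw [← h625, eq_neg_of_add_eq_zero_left h, Polynomial.natDegree_neg]
    rw [Polynomial.natDegree_C_mul (by norm_num), Polynomial.natDegree_mul (pow_ne_zero 2 hv) hr,
      Polynomial.natDegree_pow, Polynomial.natDegree_pow, natDegree_ramification] at heq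
    omega
  subst hv
  simpa using h

/-- A homomorphism `ℚ[x][y] → K` into an algebraically closed field extends along
`x ↦ g₄, y ↦ g₆²` to `A₁₀`. -/
theorem exists_hom_A10 {K : Type*} [Field K] [IsAlgClosed K] [CharZero K]
    (f : Polynomial (Polynomial ℚ) →+* K) :
    ∃ χ : A10 →+* K, ∀ u, χ (invariantHom (bivariateHom u)) = f u := by
  obtain ⟨t, ht⟩ := IsAlgClosed.exists_pow_nat_eq (f Polynomial.X) two_pos
  obtain ⟨h, hh⟩ := IsAlgClosed.exists_pow_nat_eq
    ((f Polynomial.X - 4 * f (Polynomial.C Polynomial.X) ^ 3) / 25) two_pos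
  obtain ⟨k, hk⟩ := IsAlgClosed.exists_pow_nat_eq
    ((8 * f (Polynomial.C Polynomial.X) ^ 3 - 27 * f Polynomial.X) / 25) two_pos
  let e : MvPolynomial (Fin 4) ℚ →+* K :=
    eval₂Hom (algebraMap ℚ K) ![f (Polynomial.C Polynomial.X), t, h, k]
  let χ : A10 →+* K := Ideal.Quotient.lift _ e fun a ha => by
    rw [← RingHom.mem_ker]
    refine (Ideal.span_le (I := RingHom.ker e)).2 ?_ ha
    rintro _ (rfl | rfl) <;>
      simp only [SetLike.mem_coe, RingHom.mem_ker, e, map_add, map_mul, map_pow, map_ofNat,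
        coe_eval₂Hom, eval₂_X, Matrix.cons_val, ht, hh, hk] <;>
      field_simp <;> ring
  refine ⟨χ, fun u => ?_⟩
  suffices (χ.comp (invariantHom : MvPolynomial (Fin 3) ℚ →+* A10)).comp bivariateHom = f from
    DFunLike.congr_fun this u
  have h4 : χ g4 = f (Polynomial.C Polynomial.X) := by simp [χ, e, g4]
  have h6 : χ g6 = t := by simp [χ, e, g6]
  refine Polynomial.ringHom_ext' (Polynomial.ringHom_ext' (RingHom.ext_rat _ _) ?_) ?_
  · simp [bivariateHom_C_X, h4]
  · simp [bivariateHom_X, h6, ht]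

/-- The kernel of `invariantHom` is generated by the defining relation. -/
theorem mem_span_of_invariantHom_eq_zero {q : MvPolynomial (Fin 3) ℚ}
    (hq : invariantHom q = 0) : q ∈ Ideal.span {quotientRelation} := by
  have hker : ∀ p ∈ Ideal.span {quotientRelation}, invariantHom p = 0 := fun p hp => by
    obtain ⟨r, rfl⟩ := Ideal.mem_span_singleton'.1 hp
    rw [map_mul, invariantHom_quotientRelation, mul_zero]
  obtain ⟨u, v, h⟩ := exists_sub_mem_span q
  have huv := hker _ h
  rw [map_sub, hq, zero_sub, neg_eq_zero, map_add, map_mul] at huv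
  let f : Polynomial (Polynomial ℚ) →+*
      AlgebraicClosure (FractionRing (Polynomial (Polynomial ℚ))) :=
    (algebraMap (FractionRing (Polynomial (Polynomial ℚ))) _).comp (algebraMap _ _)
  have hf : Function.Injective f :=
    (algebraMap (FractionRing (Polynomial (Polynomial ℚ))) _).injective.comp
      (IsFractionRing.injective _ _)
  have : CharZero (AlgebraicClosure (FractionRing (Polynomial (Polynomial ℚ)))) :=
    charZero_of_injective_ringHom hf
  obtain ⟨χ, hχ⟩ := exists_hom_A10 f
  have hF : invariantHom (bivariateHom ramification) + 625 * invariantHom (X 2) ^ 2 = 0 := by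
    have := invariantHom_quotientRelation
    simp only [quotientRelation, map_add, map_sub, map_mul, map_pow, map_ofNat] at this
    simpa only [ramification, map_add, map_sub, map_mul, map_pow, map_ofNat, bivariateHom_C_X,
      bivariateHom_X] using this
  have hw : invariantHom (bivariateHom (625 * u ^ 2 + v ^ 2 * ramification)) = 0 := by
    simp only [map_add, map_mul, map_pow, map_ofNat]
    linear_combination invariantHom (bivariateHom v) ^ 2 * hF +
      625 * (invariantHom (bivariateHom u) -
        invariantHom (bivariateHom v) * invariantHom (X 2)) * huv
  have hzero : 625 * u ^ 2 + v ^ 2 * ramification = 0 := by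
    apply hf
    rw [← hχ, hw, map_zero, map_zero]
  obtain ⟨rfl, rfl⟩ := eq_zero_of_sq_add_sq_mul_ramification hzero
  simpa using h

/-- if `G` is the group of ℚ-algebra automorphisms of `A₁₀` generated by
the involutions `σ₂ : (g₄,g₆,h₆,k₆) ↦ (g₄,g₆,−h₆,−k₆)` and
`σ₅ : (g₄,g₆,h₆,k₆) ↦ (g₄,−g₆,h₆,−k₆)`, then the map `x ↦ g₄, y ↦ g₆², z ↦ g₆h₆k₆`
kills `32x⁶y − 116x³y² + 27y³ + 625z²` and induces
`ℚ[x,y,z]/(32x⁶y − 116x³y² + 27y³ + 625z²) ≅ A₁₀^G`. -/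
theorem stmt_17 (σ₂ σ₅ : A10 ≃ₐ[ℚ] A10)
    (hσ₂g4 : σ₂ g4 = g4) (hσ₂g6 : σ₂ g6 = g6) (hσ₂h6 : σ₂ h6 = -h6) (hσ₂k6 : σ₂ k6 = -k6)
    (hσ₅g4 : σ₅ g4 = g4) (hσ₅g6 : σ₅ g6 = -g6) (hσ₅h6 : σ₅ h6 = h6)
    (hσ₅k6 : σ₅ k6 = -k6) :
    aeval (![g4, g6 ^ 2, g6 * h6 * k6] : Fin 3 → A10)
        (32 * (X 0 : MvPolynomial (Fin 3) ℚ) ^ 6 * X 1 - 116 * X 0 ^ 3 * X 1 ^ 2 +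
          27 * X 1 ^ 3 + 625 * X 2 ^ 2) = 0 ∧
    ∃ ψ : (MvPolynomial (Fin 3) ℚ ⧸
            Ideal.span
              {32 * (X 0 : MvPolynomial (Fin 3) ℚ) ^ 6 * X 1 -
                116 * X 0 ^ 3 * X 1 ^ 2 + 27 * X 1 ^ 3 + 625 * X 2 ^ 2})
          ≃ₐ[ℚ] (fixedSubalgebra ℚ A10 (Subgroup.closure {σ₂, σ₅})),
      ∀ q : MvPolynomial (Fin 3) ℚ,
        (ψ (Ideal.Quotient.mk _ q) : A10) =
          aeval (![g4, g6 ^ 2, g6 * h6 * k6] : Fin 3 → A10) q := by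
  refine ⟨invariantHom_quotientRelation, ?_⟩
  let Φ : MvPolynomial (Fin 3) ℚ →ₐ[ℚ] fixedSubalgebra ℚ A10 (Subgroup.closure {σ₂, σ₅}) :=
    invariantHom.codRestrict _ (invariantHom_mem_fixedSubalgebra σ₂ σ₅
      hσ₂g4 hσ₂g6 hσ₂h6 hσ₂k6 hσ₅g4 hσ₅g6 hσ₅h6 hσ₅k6)
  have hΦ : ∀ q ∈ Ideal.span {quotientRelation}, Φ q = 0 := fun q hq => by
    obtain ⟨r, rfl⟩ := Ideal.mem_span_singleton'.1 hq
    refine Subtype.ext ?_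
    change invariantHom (r * quotientRelation) = 0
    rw [map_mul, invariantHom_quotientRelation, mul_zero]
  refine ⟨AlgEquiv.ofBijective (Ideal.Quotient.liftₐ _ Φ hΦ) ⟨?_, ?_⟩, fun q => rfl⟩
  · rw [injective_iff_map_eq_zero]
    intro a ha
    obtain ⟨q, rfl⟩ := Ideal.Quotient.mk_surjective a
    exact Ideal.Quotient.eq_zero_iff_mem.2
      (mem_span_of_invariantHom_eq_zero (congrArg Subtype.val ha))
  · rintro ⟨x, hx⟩
    obtain ⟨q, rfl⟩ := mem_range_of_fixed σ₂ σ₅ hσ₂g4 hσ₂g6 hσ₂h6 hσ₂k6 hσ₅g4 hσ₅g6 hσ₅h6 hσ₅k6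
      (hx σ₂ (Subgroup.subset_closure (by simp))) (hx σ₅ (Subgroup.subset_closure (by simp)))
    exact ⟨Ideal.Quotient.mk _ q, rfl⟩
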